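/- arXiv:2407.14050 — 15 statements merged into one kernel-verified Lean document; each statement's English description precedes it below -/
import Mathlib

section
/- Let g and κ be real numbers with g ≠ 0, and let Z be the 6×6 real matrix Z = (1/2)·M where the rows of M are (-1,0,0,0,-g,0), (0,0,0,-g,κ,-1), (0,0,0,0,-1,κ), (0,g,0,-1,0,0), (g,κ,1,0,0,0), (0,1,κ,0,0,0). Then Z is stable (every complex eigenvalue of Z has strictly negative real part) if and only if either κ = 0, or both 0 < |κ| < 1 and 0 < g² < (1-κ²)/|κ|. -/
/-- A real cubic `x³ + x² + b x + c` with `0 < c < b` has no complex root in the closed right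
half-plane. -/
lemma re_neg_of_cubic_eq_zero {b c : ℝ} (hc : 0 < c) (hcb : c < b) {z : ℂ}
    (hz : z ^ 3 + z ^ 2 + b * z + c = 0) : z.re < 0 := by
  by_contra! hu
  have hre := congrArg Complex.re hz
  have him := congrArg Complex.im hz
  simp [pow_succ] at hre him
  have hb : 0 < b := hc.trans hcb
  set u := z.re
  set v := z.im
  have hfac : v * (3 * u ^ 2 - v ^ 2 + 2 * u + b) = 0 := by linear_combination him
  have hbu : 0 ≤ b * u := by positivity
  have hu2 : 0 ≤ u ^ 2 := by positivity
  have hu3 : 0 ≤ u ^ 3 := by positivity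
  rcases mul_eq_zero.mp hfac with hv | hv
  · rw [hv] at hre
    nlinarith
  · have hsq : v ^ 2 = 3 * u ^ 2 + 2 * u + b := by linarith
    have hsum : u ^ 3 + u ^ 2 + b * u + c - (3 * u + 1) * (3 * u ^ 2 + 2 * u + b) = 0 := by
      rw [← hsq]; linear_combination hre
    nlinarith

/-- Converse Routh-Hurwitz criterion for a real cubic `x³ + x² + b x + c`. -/
lemma cubic_coeffs_of_roots_re_neg {b c : ℝ}
    (h : ∀ z : ℂ, z ^ 3 + z ^ 2 + b * z + c = 0 → z.re < 0) : 0 < c ∧ c < b := by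
  have hcont : Continuous fun x : ℝ => x ^ 3 + x ^ 2 + b * x + c := by fun_prop
  constructor
  · by_contra! hc
    have hR : 0 ≤ 1 + |b| + |c| := by positivity
    obtain ⟨x, hx, hx0⟩ := intermediate_value_Icc hR hcont.continuousOn
      (show (0 : ℝ) ∈ Set.Icc _ _ from ⟨by simpa using hc, by
        nlinarith [neg_abs_le b, neg_abs_le c, abs_nonneg b, abs_nonneg c,
          mul_nonneg (abs_nonneg b) (abs_nonneg c), pow_nonneg hR 3,
          mul_nonneg hR (add_nonneg (neg_le_iff_add_nonneg.mp (neg_abs_le b)) hR)]⟩)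
    have := h x (by exact_mod_cast hx0)
    rw [Complex.ofReal_re] at this
    exact absurd hx.1 (not_le.mpr this)
  · by_contra! hbc
    have hR : -(2 + |b| + |c|) ≤ -1 := by linarith [abs_nonneg b, abs_nonneg c]
    obtain ⟨r, hr, hr0⟩ := intermediate_value_Icc hR hcont.continuousOn
      (show (0 : ℝ) ∈ Set.Icc _ _ from ⟨by
        set R := 2 + |b| + |c| with hRdef
        have hR2 : 2 ≤ R := by linarith [abs_nonneg b, abs_nonneg c]
        have h1 : R ^ 2 * 1 ≤ R ^ 2 * (R - 1) := by gcongr; linarith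
        have h2 : -b * R ≤ |b| * R := by gcongr; exact neg_le_abs b
        have h3 : c ≤ |c| * R := by nlinarith [le_abs_self c, abs_nonneg c]
        have h4 : R * R = 2 * R + |b| * R + |c| * R := by rw [hRdef]; ring
        nlinarith, by linarith⟩)
    obtain ⟨w, hw⟩ : ∃ w : ℂ, w ^ 2 = ((1 + r) ^ 2 - 4 * (b + r * (1 + r)) : ℝ) :=
      IsAlgClosed.exists_pow_nat_eq _ two_pos
    push_cast at hw
    have hr0' : (r : ℂ) ^ 3 + r ^ 2 + b * r + c = 0 := by exact_mod_cast hr0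
    have key : ∀ s : ℂ, s ^ 2 = (1 + r) ^ 2 - 4 * (b + r * (1 + r)) → s.re < 1 + r := by
      intro s hs
      have := h ((-(1 + r : ℝ) + s) / 2) (by
        push_cast
        linear_combination ((-(1 + (r : ℂ)) + s) / 2 - r) / 4 * hs + hr0')
      simp at this
      linarith
    have h1 := key w hw
    have h2 := key (-w) (by rw [neg_sq, hw])
    rw [Complex.neg_re] at h2
    linarith [hr.2]

/-- The characteristic polynomial of the drift matrix splits into two cubics. -/
lemma det_scalar_sub_drift (g κ x : ℂ) :
    (!![x + 1, 0, 0, 0, g, 0;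
        0, x, 0, g, -κ, 1;
        0, 0, x, 0, 1, -κ;
        0, -g, 0, x + 1, 0, 0;
        -g, -κ, -1, 0, x, 0;
        0, -1, -κ, 0, 0, x] : Matrix (Fin 6) (Fin 6) ℂ).det =
      (x ^ 3 + x ^ 2 + (1 + g ^ 2 - κ ^ 2) * x + (1 - κ ^ 2 + g ^ 2 * κ)) *
      (x ^ 3 + x ^ 2 + (1 + g ^ 2 - κ ^ 2) * x + (1 - κ ^ 2 - g ^ 2 * κ)) := by
  simp [Matrix.det_succ_row_zero, Fin.sum_univ_succ, Fin.succAbove]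
  ring

theorem stmt_0 (g κ : ℝ) (hg : g ≠ 0)
    (Z : Matrix (Fin 6) (Fin 6) ℝ)
    (hZ : Z = ((1 : ℝ) / 2) •
      !![-1, 0, 0, 0, -g, 0;
          0, 0, 0, -g, κ, -1;
          0, 0, 0, 0, -1, κ;
          0, g, 0, -1, 0, 0;
          g, κ, 1, 0, 0, 0;
          0, 1, κ, 0, 0, 0]) :
    (∀ μ : ℂ, (Z.map (Complex.ofReal)).charpoly.IsRoot μ → μ.re < 0) ↔
      (κ = 0 ∨ (0 < |κ| ∧ |κ| < 1 ∧ 0 < g ^ 2 ∧ g ^ 2 < (1 - κ ^ 2) / |κ|)) := by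
  have hroot : ∀ μ : ℂ, (Z.map (Complex.ofReal)).charpoly.IsRoot μ ↔
      ((2 * μ) ^ 3 + (2 * μ) ^ 2 + (1 + g ^ 2 - κ ^ 2 : ℝ) * (2 * μ) +
        (1 - κ ^ 2 + g ^ 2 * κ : ℝ) = 0 ∨
      (2 * μ) ^ 3 + (2 * μ) ^ 2 + (1 + g ^ 2 - κ ^ 2 : ℝ) * (2 * μ) +
        (1 - κ ^ 2 - g ^ 2 * κ : ℝ) = 0) := by
    intro μ
    have hM : Matrix.scalar (Fin 6) μ - Z.map Complex.ofReal = (1 / 2 : ℂ) •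
        !![2 * μ + 1, 0, 0, 0, (g : ℂ), 0;
          0, 2 * μ, 0, (g : ℂ), -(κ : ℂ), 1;
          0, 0, 2 * μ, 0, 1, -(κ : ℂ);
          0, -(g : ℂ), 0, 2 * μ + 1, 0, 0;
          -(g : ℂ), -(κ : ℂ), -1, 0, 2 * μ, 0;
          0, -1, -(κ : ℂ), 0, 0, 2 * μ] := by
      subst hZ
      ext i j
      fin_cases i <;> fin_cases j <;> simp <;> ring
    rw [Polynomial.IsRoot, Matrix.eval_charpoly, hM, Matrix.det_smul, det_scalar_sub_drift,
      mul_eq_zero, mul_eq_zero]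
    push_cast
    simp
  have hg2 : 0 < g ^ 2 := by positivity
  have hstable : (∀ μ : ℂ, (Z.map (Complex.ofReal)).charpoly.IsRoot μ → μ.re < 0) ↔
      ((0 < 1 - κ ^ 2 + g ^ 2 * κ ∧ 1 - κ ^ 2 + g ^ 2 * κ < 1 + g ^ 2 - κ ^ 2) ∧
        (0 < 1 - κ ^ 2 - g ^ 2 * κ ∧ 1 - κ ^ 2 - g ^ 2 * κ < 1 + g ^ 2 - κ ^ 2)) := by
    constructor
    · intro h
      constructor <;> refine cubic_coeffs_of_roots_re_neg fun z hz => ?_ <;>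
        have := h (z / 2) ((hroot _).mpr (by rw [mul_div_cancel₀ z two_ne_zero]; tauto)) <;>
        simp at this <;> linarith
    · rintro ⟨⟨h1, h2⟩, h3, h4⟩ μ hμ
      have h2μ : (2 * μ).re < 0 := ((hroot μ).mp hμ).elim
        (re_neg_of_cubic_eq_zero h1 h2) (re_neg_of_cubic_eq_zero h3 h4)
      simp at h2μ
      linarith
  rw [hstable]
  rcases eq_or_ne κ 0 with rfl | hκ
  · simp [hg2]
  have hpos : 0 < |κ| := abs_pos.mpr hκ
  simp only [hκ, hpos, hg2, false_or, true_and, lt_div_iff₀ hpos, abs_lt]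
  constructor
  · rintro ⟨⟨h1, h2⟩, h3, h4⟩
    refine ⟨⟨by nlinarith, by nlinarith⟩, ?_⟩
    rcases abs_cases κ with ⟨h, _⟩ | ⟨h, _⟩ <;> rw [h] <;> linarith
  · rintro ⟨⟨h1, h2⟩, h3⟩
    have h4 : g ^ 2 * κ ≤ g ^ 2 * |κ| := by gcongr; exact le_abs_self κ
    have h5 : g ^ 2 * -κ ≤ g ^ 2 * |κ| := by gcongr; exact neg_le_abs κ
    refine ⟨⟨?_, ?_⟩, ?_, ?_⟩ <;> nlinarith
end

section
/- Let g and κ be real numbers, and let Z be the 6×6 real matrix Z = (1/2)·M where the rows of M are (-1,0,0,0,-g,0), (0,0,0,-g,κ,-1), (0,0,0,0,-1,κ), (0,g,0,-1,0,0), (g,κ,1,0,0,0), (0,1,κ,0,0,0). Then the characteristic polynomial of Z (in the variable λ) equals the product of the two cubic polynomials λ³ + λ²/2 + ((1-κ²+g²)/4)λ + (1-κ²-g²κ)/8 and λ³ + λ²/2 + ((1-κ²+g²)/4)λ + (1-κ²+g²κ)/8. -/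
open Polynomial

/-- The characteristic polynomial of the drift matrix `Z` of the single-noise
model factors as the product of two explicit cubics. -/
theorem stmt_1 (g κ : ℝ)
    (Z : Matrix (Fin 6) (Fin 6) ℝ)
    (hZ : Z = ((1 : ℝ) / 2) •
      !![-1, 0, 0, 0, -g, 0;
          0, 0, 0, -g, κ, -1;
          0, 0, 0, 0, -1, κ;
          0, g, 0, -1, 0, 0;
          g, κ, 1, 0, 0, 0;
          0, 1, κ, 0, 0, 0]) :
    Z.charpoly =
      (X ^ 3 + C ((1 : ℝ) / 2) * X ^ 2 + C ((1 - κ ^ 2 + g ^ 2) / 4) * X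
          + C ((1 - κ ^ 2 - g ^ 2 * κ) / 8)) *
        (X ^ 3 + C ((1 : ℝ) / 2) * X ^ 2 + C ((1 - κ ^ 2 + g ^ 2) / 4) * X
          + C ((1 - κ ^ 2 + g ^ 2 * κ) / 8)) := by
  subst hZ
  refine Polynomial.funext fun x => ?_
  rw [Matrix.eval_charpoly]
  simp [Matrix.det_succ_row_zero, Fin.sum_univ_succ, Fin.succAbove, Matrix.scalar_apply,
    Matrix.diagonal_apply]
  ring
end

section
/- For real numbers β̃, κ, g define N(β̃,κ,g) = β̃⁴ - (1-κ²)(2+2κ² - g⁴κ²)β̃² + (1-κ²)²((1-κ²)² - g⁴κ²). Suppose g ≠ 0, 0 < |κ| < 1 and g² < (1-κ²)/|κ|. Then there exists β̃ > 1 with N(β̃,κ,g) < 0 if and only if g² < √(max{4(1-κ²)² - κ⁶, 0}) / (|κ|·√(1-κ²)). -/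
/-- The inequality on `g ^ 2` with the square roots cleared. -/
theorem sq_lt_threshold_iff {κ g : ℝ} (hκ0 : 0 < |κ|) (hκ1 : |κ| < 1) :
    g ^ 2 < Real.sqrt (max (4 * (1 - κ ^ 2) ^ 2 - κ ^ 6) 0)
        / (|κ| * Real.sqrt (1 - κ ^ 2)) ↔
      g ^ 4 * κ ^ 2 * (1 - κ ^ 2) < 4 * (1 - κ ^ 2) ^ 2 - κ ^ 6 := by
  have hs : 0 < 1 - κ ^ 2 := sub_pos.2 ((sq_lt_one_iff_abs_lt_one κ).2 hκ1)
  have hsq : (g ^ 2 * (|κ| * Real.sqrt (1 - κ ^ 2))) ^ 2 = g ^ 4 * κ ^ 2 * (1 - κ ^ 2) := by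
    rw [mul_pow, mul_pow, sq_abs, Real.sq_sqrt hs.le]
    ring
  have hnonneg : 0 ≤ g ^ 4 * κ ^ 2 * (1 - κ ^ 2) := by rw [← hsq]; positivity
  rw [lt_div_iff₀ (mul_pos hκ0 (Real.sqrt_pos.2 hs)), Real.lt_sqrt (by positivity), hsq,
    lt_max_iff, or_iff_left hnonneg.not_gt]

/-- In the single-noise model, under the stability conditions, there exists an
inverse-temperature parameter `β̃ > 1` making the determinant numerator
`N(β̃,κ,g)` negative (i.e. the stationary state entangled) if and only if
`g² < √(max{4(1-κ²)² - κ⁶, 0})/(|κ|√(1-κ²))`. -/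
theorem stmt_4 (N : ℝ → ℝ → ℝ → ℝ)
    (hN : ∀ βt κ g : ℝ, N βt κ g =
      βt ^ 4 - (1 - κ ^ 2) * (2 + 2 * κ ^ 2 - g ^ 4 * κ ^ 2) * βt ^ 2
        + (1 - κ ^ 2) ^ 2 * ((1 - κ ^ 2) ^ 2 - g ^ 4 * κ ^ 2))
    (κ g : ℝ) (hg : g ≠ 0) (hκ0 : 0 < |κ|) (hκ1 : |κ| < 1)
    (hstab : g ^ 2 < (1 - κ ^ 2) / |κ|) :
    (∃ βt : ℝ, 1 < βt ∧ N βt κ g < 0) ↔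
      g ^ 2 < Real.sqrt (max (4 * (1 - κ ^ 2) ^ 2 - κ ^ 6) 0)
        / (|κ| * Real.sqrt (1 - κ ^ 2)) := by
  have hκ : 0 < κ ^ 2 := by rw [← sq_abs]; positivity
  have hs : 0 < 1 - κ ^ 2 := sub_pos.2 ((sq_lt_one_iff_abs_lt_one κ).2 hκ1)
  have hG : 0 < (1 - κ ^ 2) * (g ^ 4 * κ ^ 2) := by positivity
  have hN1 : N 1 κ g =
      κ ^ 2 * (g ^ 4 * κ ^ 2 * (1 - κ ^ 2) - (4 * (1 - κ ^ 2) ^ 2 - κ ^ 6)) := by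
    rw [hN]
    ring
  have hN1_neg : N 1 κ g < 0 ↔
      g ^ 4 * κ ^ 2 * (1 - κ ^ 2) < 4 * (1 - κ ^ 2) ^ 2 - κ ^ 6 := by
    rw [hN1, ← sub_neg (a := g ^ 4 * κ ^ 2 * (1 - κ ^ 2))]
    exact ⟨fun h => neg_of_mul_neg_right h hκ.le, mul_neg_of_pos_of_neg hκ⟩
  rw [sq_lt_threshold_iff hκ0 hκ1, ← hN1_neg]
  constructor
  · rintro ⟨b, hb, hNb⟩
    have hb2 : 0 < b ^ 2 - 1 := by nlinarith
    have hdiff : N b κ g - N 1 κ g = (b ^ 2 - 1) *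
        ((b ^ 2 - 1) + 2 * (κ ^ 2) ^ 2 + (1 - κ ^ 2) * (g ^ 4 * κ ^ 2)) := by
      rw [hN, hN]
      ring
    have hpos : 0 < N b κ g - N 1 κ g := by
      rw [hdiff]
      positivity
    linarith
  · intro h
    have hcont : Continuous fun b => N b κ g := by
      simp only [hN]
      fun_prop
    have hev : ∀ᶠ b in nhdsWithin (1 : ℝ) (Set.Ioi 1), N b κ g < 0 :=
      (hcont.continuousAt.eventually_lt_const h).filter_mono nhdsWithin_le_nhds
    exact (eventually_mem_nhdsWithin.and hev).exists
end

section
/- For real numbers β̃, κ, g define N(β̃,κ,g) = β̃⁴ - (1-κ²)(2+2κ² - g⁴κ²)β̃² + (1-κ²)²((1-κ²)² - g⁴κ²). For every real κ with 0 < |κ| < √((5-√13)/2), there exist a real g and a real β̃ with g ≠ 0, g² < (1-κ²)/|κ|, β̃ > 1 and N(β̃,κ,g) < 0. -/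
/-- For every `κ` with `0 < |κ| < √((5-√13)/2)` one can find a coupling
strength `g` compatible with stability and an inverse-temperature parameter
`β̃ > 1` for which the determinant numerator `N(β̃,κ,g)` is negative, i.e. the
stationary state of the single-noise model is entangled. -/
theorem stmt_6 (N : ℝ → ℝ → ℝ → ℝ)
    (hN : ∀ βt κ g : ℝ, N βt κ g =
      βt ^ 4 - (1 - κ ^ 2) * (2 + 2 * κ ^ 2 - g ^ 4 * κ ^ 2) * βt ^ 2
        + (1 - κ ^ 2) ^ 2 * ((1 - κ ^ 2) ^ 2 - g ^ 4 * κ ^ 2)) :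
    ∀ κ : ℝ, 0 < |κ| → |κ| < Real.sqrt ((5 - Real.sqrt 13) / 2) →
      ∃ g βt : ℝ, g ≠ 0 ∧ g ^ 2 < (1 - κ ^ 2) / |κ| ∧ 1 < βt ∧ N βt κ g < 0 := by
  intro κ hκ hlt
  have h13 : (3.6 : ℝ) < √13 := by
    rw [Real.lt_sqrt (by norm_num)]
    norm_num
  have hx : κ ^ 2 < 0.7 := by
    have h := (Real.lt_sqrt (abs_nonneg κ)).1 hlt
    rw [sq_abs] at h
    linarith
  have hx0 : 0 < κ ^ 2 := by
    rw [← sq_abs]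
    positivity
  have hneg : N (1 + 0) κ 0 < 0 := by
    have hcubic : (κ ^ 2) ^ 3 - 4 * (κ ^ 2) ^ 2 + 8 * κ ^ 2 - 4 < 0 := by
      nlinarith [mul_pos hx0 (sub_pos.2 hx), mul_pos (mul_pos hx0 hx0) (sub_pos.2 hx)]
    rw [hN]
    linear_combination mul_neg_of_pos_of_neg hx0 hcubic
  have hcont : Continuous fun t : ℝ => N (1 + t) κ t := by
    simp only [hN]
    fun_prop
  have hstable : (0 : ℝ) ^ 2 < (1 - κ ^ 2) / |κ| := by
    rw [zero_pow two_ne_zero]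
    exact div_pos (by linarith) hκ
  have hNear : ∀ᶠ t : ℝ in nhdsWithin 0 (Set.Ioi 0),
      N (1 + t) κ t < 0 ∧ t ^ 2 < (1 - κ ^ 2) / |κ| :=
    nhdsWithin_le_nhds <|
      (hcont.continuousAt.eventually_lt continuousAt_const hneg).and
        ((continuous_pow 2).continuousAt.eventually_lt continuousAt_const hstable)
  obtain ⟨t, ⟨hNt, hst⟩, ht⟩ := (hNear.and self_mem_nhdsWithin).exists
  have ht0 : 0 < t := ht
  exact ⟨t, 1 + t, ht0.ne', hst, by linarith, hNt⟩
end

section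
/- Let κ and g be real numbers with |κ| < 1 and 0 < g² < (1-κ²)/|κ|. Then 6 - (2+g²)²κ² + (g⁴ - 2)κ⁴ > 0. -/
/-- Inequality (B.1) of the paper: under the stability conditions `|κ| < 1` and
`0 < g² < (1-κ²)/|κ|`, one has `6 - (2+g²)²κ² + (g⁴-2)κ⁴ > 0`. -/
theorem stmt_7 (κ g : ℝ) (hκ : |κ| < 1) (hg0 : 0 < g ^ 2)
    (hg : g ^ 2 < (1 - κ ^ 2) / |κ|) :
    6 - (2 + g ^ 2) ^ 2 * κ ^ 2 + (g ^ 4 - 2) * κ ^ 4 > 0 := by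
  have hk : 0 < |κ| := by
    rcases (abs_nonneg κ).eq_or_lt with h | h
    · rw [← h, div_zero] at hg
      exact absurd hg hg0.not_gt
    · exact h
  rw [lt_div_iff₀ hk] at hg
  have hκ4 : κ ^ 4 = |κ| ^ 4 := by rw [← abs_pow, abs_of_nonneg (by positivity)]
  rw [← sq_abs κ] at hg ⊢
  rw [hκ4]
  generalize |κ| = k at *
  have hm : 0 < g ^ 2 * k := mul_pos hg0 hk
  have hu : 0 < 1 - k ^ 2 := hm.trans hg
  have hm2 : (g ^ 2 * k) ^ 2 ≤ 1 := by nlinarith [sq_nonneg k]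
  have h1 : 0 < k * (1 - k ^ 2 - g ^ 2 * k) := mul_pos hk (sub_pos.mpr hg)
  have h2 : 0 ≤ (1 - k ^ 2) * (1 - (g ^ 2 * k) ^ 2) := mul_nonneg hu.le (sub_nonneg.mpr hm2)
  have h3 : 0 < (1 - k ^ 2) * (5 + 2 * k ^ 2 - 4 * k) :=
    mul_pos hu (by nlinarith [sq_nonneg k])
  linear_combination 4 * h1 + h2 + h3
end

section
/- Let κ and g be real numbers with |κ| < 1 and 0 < g² < (1-κ²)/|κ|. Then 4 + (2-g²)²κ² - (3g⁴+14)κ⁴ + 2(g⁴+4)κ⁶ - 2κ⁸ > 0. -/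
/-- Inequality (B.2) of the paper: under the stability conditions `|κ| < 1` and
`0 < g² < (1-κ²)/|κ|`, one has `4 + (2-g²)²κ² - (3g⁴+14)κ⁴ + 2(g⁴+4)κ⁶ - 2κ⁸ > 0`. -/
theorem stmt_8 (κ g : ℝ) (hκ : |κ| < 1) (hg0 : 0 < g ^ 2)
    (hg : g ^ 2 < (1 - κ ^ 2) / |κ|) :
    4 + (2 - g ^ 2) ^ 2 * κ ^ 2 - (3 * g ^ 4 + 14) * κ ^ 4
      + 2 * (g ^ 4 + 4) * κ ^ 6 - 2 * κ ^ 8 > 0 := by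
  have hk : 0 < |κ| := by
    rcases (abs_nonneg κ).eq_or_lt with h | h
    · rw [← h, div_zero] at hg
      linarith
    · exact h
  rw [lt_div_iff₀ hk, ← sq_abs κ] at hg
  have h4 : κ ^ 4 = |κ| ^ 4 := ((by decide : Even 4).pow_abs κ).symm
  have h6 : κ ^ 6 = |κ| ^ 6 := ((by decide : Even 6).pow_abs κ).symm
  have h8 : κ ^ 8 = |κ| ^ 8 := ((by decide : Even 8).pow_abs κ).symm
  rw [← sq_abs κ, h4, h6, h8]
  generalize |κ| = k at *
  obtain ⟨t, ht⟩ : ∃ t, t = g ^ 2 * k := ⟨_, rfl⟩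
  rw [← ht] at hg
  have ht0 : 0 < t := ht ▸ mul_pos hg0 hk
  obtain ⟨x, hx⟩ : ∃ x, x = k ^ 2 := ⟨_, rfl⟩
  rw [← hx] at hg
  have hx0 : 0 < x := hx ▸ pow_pos hk 2
  have hx1 : 0 < 1 - x := by linarith
  have key : 4 + (2 - g ^ 2) ^ 2 * k ^ 2 - (3 * g ^ 4 + 14) * k ^ 4
      + 2 * (g ^ 4 + 4) * k ^ 6 - 2 * k ^ 8
      = (1 - x) * (4 * (1 - k) + x * (7 - 4 * x + x ^ 2))
        + 4 * k * (1 - x - t) + t ^ 2 * (1 - x) ^ 2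
        + x * (1 - x) * ((1 - x) ^ 2 - t ^ 2) := by
    rw [ht, hx]
    ring
  rw [key]
  have h1 : 0 < 1 - k := by linarith
  have h2 : 0 < 7 - 4 * x + x ^ 2 := by nlinarith
  have h3 : 0 < 1 - x - t := by linarith
  have h5 : 0 < (1 - x) ^ 2 - t ^ 2 := by nlinarith
  positivity
end

section
/- Let κ, g, β̃ be real numbers with |κ| < 1, β̃ > 1 and 0 < g² < (1-κ²)/|κ|. Then 2β̃²(2 - g²κ²) + 2(1-κ²)(g²κ⁴ + (g⁴+g²+2)κ² - 2) > 0. -/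
/-- Inequality (B.3) of the paper: under the stability conditions `|κ| < 1`,
`0 < g² < (1-κ²)/|κ|` and `β̃ > 1` (here `βt` stands for `β̃`), one has
`2β̃²(2 - g²κ²) + 2(1-κ²)(g²κ⁴ + (g⁴+g²+2)κ² - 2) > 0`. -/
theorem stmt_9 (κ g βt : ℝ) (hκ : |κ| < 1) (hβ : βt > 1) (hg0 : 0 < g ^ 2)
    (hg : g ^ 2 < (1 - κ ^ 2) / |κ|) :
    2 * βt ^ 2 * (2 - g ^ 2 * κ ^ 2)
      + 2 * (1 - κ ^ 2) * (g ^ 2 * κ ^ 4 + (g ^ 4 + g ^ 2 + 2) * κ ^ 2 - 2) > 0 := by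
  have hκ0 : 0 < |κ| := by
    rcases (abs_nonneg κ).eq_or_lt with h | h
    · rw [← h, div_zero] at hg
      linarith
    · exact h
  rw [lt_div_iff₀ hκ0] at hg
  simp only [show κ ^ 4 = (κ ^ 2) ^ 2 by ring, show g ^ 4 = (g ^ 2) ^ 2 by ring]
  rw [← sq_abs κ] at hg ⊢
  generalize |κ| = k at *
  generalize g ^ 2 = x at *
  have hk2 : 0 < k ^ 2 := by positivity
  have hk2' : k ^ 2 < 1 := by nlinarith
  have hxk : x * k < 1 := by linarith
  have hxk2 : x * k ^ 2 < 1 := by nlinarith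
  have hxk4 : x * k ^ 4 < 1 := by
    have : 0 < x * k ^ 2 := by positivity
    nlinarith
  have hβ2 : 1 < βt ^ 2 := by nlinarith
  have hβ_term : 0 < (βt ^ 2 - 1) * (2 - x * k ^ 2) :=
    mul_pos (by linarith) (by linarith)
  have hx2 : 0 < (1 - k ^ 2) * x ^ 2 := mul_pos (by linarith) (by positivity)
  have hrest : 0 < k ^ 2 * (4 - 2 * k ^ 2 - x * k ^ 4 + (1 - k ^ 2) * x ^ 2) :=
    mul_pos hk2 (by linarith)
  linarith
end

section
/- Let g and κ be real numbers with g ≠ 0, and let Z be the 8×8 real matrix Z = (1/2)·M where the rows of M are (-1,0,0,0,0,-g,0,0), (0,0,0,0,-g,κ,-1,0), (0,0,0,0,0,-1,κ,-g), (0,0,0,-1,0,0,-g,0), (0,g,0,0,-1,0,0,0), (g,κ,1,0,0,0,0,0), (0,1,κ,g,0,0,0,0), (0,0,g,0,0,0,0,-1). Then Z is stable (every complex eigenvalue of Z has strictly negative real part) if and only if κ² < min{1+g⁴, 2}. -/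
/-- The drift matrix of the two-noise model, without the overall factor `1/2`. -/
def twoNoiseMatrix (g κ : ℝ) : Matrix (Fin 8) (Fin 8) ℝ :=
  !![-1, 0, 0, 0, 0, -g, 0, 0;
      0, 0, 0, 0, -g, κ, -1, 0;
      0, 0, 0, 0, 0, -1, κ, -g;
      0, 0, 0, -1, 0, 0, -g, 0;
      0, g, 0, 0, -1, 0, 0, 0;
      g, κ, 1, 0, 0, 0, 0, 0;
      0, 1, κ, g, 0, 0, 0, 0;
      0, 0, g, 0, 0, 0, 0, -1]

theorem isRoot_charpoly_iff_exists_mulVec {n : Type*} [Fintype n] [DecidableEq n]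
    (A : Matrix n n ℂ) (μ : ℂ) :
    A.charpoly.IsRoot μ ↔ ∃ v ≠ 0, A.mulVec v = μ • v := by
  rw [Polynomial.IsRoot.def, Matrix.eval_charpoly, ← Matrix.exists_mulVec_eq_zero_iff]
  refine exists_congr fun v => and_congr_right fun _ => ?_
  rw [Matrix.sub_mulVec, sub_eq_zero, Matrix.scalar_apply, ← Matrix.smul_one_eq_diagonal,
    Matrix.smul_mulVec, Matrix.one_mulVec, eq_comm]

theorem half_twoNoiseMatrix_mulVec_eq_iff (g κ : ℝ) (μ : ℂ) (v : Fin 8 → ℂ) :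
    ((((1 : ℝ) / 2) • twoNoiseMatrix g κ).map Complex.ofReal).mulVec v = μ • v ↔
      -v 0 - g * v 5 = 2 * μ * v 0 ∧
      -g * v 4 + κ * v 5 - v 6 = 2 * μ * v 1 ∧
      -v 5 + κ * v 6 - g * v 7 = 2 * μ * v 2 ∧
      -v 3 - g * v 6 = 2 * μ * v 3 ∧
      g * v 1 - v 4 = 2 * μ * v 4 ∧
      g * v 0 + κ * v 1 + v 2 = 2 * μ * v 5 ∧
      v 1 + κ * v 2 + g * v 3 = 2 * μ * v 6 ∧
      g * v 2 - v 7 = 2 * μ * v 7 := by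
  have halve (a b c : ℂ) (h : b = 2 * a) : a = μ * c ↔ b = 2 * μ * c := by
    rw [h, mul_assoc, mul_right_inj' two_ne_zero]
  simp only [funext_iff, Fin.forall_fin_succ, Fin.forall_fin_zero, Matrix.mulVec, dotProduct,
    Fin.sum_univ_eight, Pi.smul_apply, smul_eq_mul, and_true]
  refine and_congr ?_ <| and_congr ?_ <| and_congr ?_ <| and_congr ?_ <| and_congr ?_ <|
    and_congr ?_ <| and_congr ?_ ?_
  all_goals
    refine halve _ _ _ ?_
    simp [twoNoiseMatrix]
    ring

/-- Away from `μ = -1/2`, the eigenvalues of the drift matrix are the roots of a quartic. -/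
theorem isRoot_charpoly_half_twoNoiseMatrix_iff (g κ : ℝ) (μ : ℂ) (hμ : 2 * μ + 1 ≠ 0) :
    ((((1 : ℝ) / 2) • twoNoiseMatrix g κ).map Complex.ofReal).charpoly.IsRoot μ ↔
      ((2 * μ) ^ 2 + 2 * μ + g ^ 2) ^ 2 = ((κ : ℂ) ^ 2 - 1) * (2 * μ + 1) ^ 2 := by
  rw [isRoot_charpoly_iff_exists_mulVec]
  simp only [half_twoNoiseMatrix_mulVec_eq_iff]
  generalize 2 * μ = l at *
  constructor
  · rintro ⟨v, hv, h0, h1, h2, h3, h4, h5, h6, h7⟩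
    by_contra hD
    have hD' : (l ^ 2 + l + (g : ℂ) ^ 2) ^ 2 - ((κ : ℂ) ^ 2 - 1) * (l + 1) ^ 2 ≠ 0 :=
      sub_ne_zero.mpr hD
    -- the two sectors, symmetric and antisymmetric under exchange of the modes
    have sector (s : ℂ) (hs : s ^ 2 = 1) : v 1 + s * v 2 = 0 ∧ v 5 + s * v 6 = 0 := by
      have hQ : (l ^ 2 + l + (g : ℂ) ^ 2) * (v 1 + s * v 2) =
          (κ - s) * (l + 1) * (v 5 + s * v 6) := by
        linear_combination -(l + 1) * h1 - s * (l + 1) * h2 + g * h4 + g * s * h7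
          + (l + 1) * v 6 * hs
      have hP : (l ^ 2 + l + (g : ℂ) ^ 2) * (v 5 + s * v 6) =
          (κ + s) * (l + 1) * (v 1 + s * v 2) := by
        linear_combination -(l + 1) * h5 - s * (l + 1) * h6 - g * h0 - g * s * h3
          - (l + 1) * v 2 * hs
      constructor <;> apply (mul_eq_zero.mp _).resolve_left hD'
      · linear_combination (l ^ 2 + l + (g : ℂ) ^ 2) * hQ + (κ - s) * (l + 1) * hP
          - (l + 1) ^ 2 * (v 1 + s * v 2) * hs
      · linear_combination (l ^ 2 + l + (g : ℂ) ^ 2) * hP + (κ + s) * (l + 1) * hQ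
          - (l + 1) ^ 2 * (v 5 + s * v 6) * hs
    obtain ⟨hq, hp⟩ := sector 1 (by norm_num)
    obtain ⟨hq', hp'⟩ := sector (-1) (by norm_num)
    have e1 : v 1 = 0 := by linear_combination (hq + hq') / 2
    have e2 : v 2 = 0 := by linear_combination (hq - hq') / 2
    have e5 : v 5 = 0 := by linear_combination (hp + hp') / 2
    have e6 : v 6 = 0 := by linear_combination (hp - hp') / 2
    have e0 : v 0 = 0 := (mul_eq_zero.mp
      (by linear_combination -h0 - g * e5 : (l + 1) * v 0 = 0)).resolve_left hμ
    have e3 : v 3 = 0 := (mul_eq_zero.mp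
      (by linear_combination -h3 - g * e6 : (l + 1) * v 3 = 0)).resolve_left hμ
    have e4 : v 4 = 0 := (mul_eq_zero.mp
      (by linear_combination -h4 + g * e1 : (l + 1) * v 4 = 0)).resolve_left hμ
    have e7 : v 7 = 0 := (mul_eq_zero.mp
      (by linear_combination -h7 + g * e2 : (l + 1) * v 7 = 0)).resolve_left hμ
    refine hv (funext fun i => ?_)
    fin_cases i <;> assumption
  · intro hD
    obtain ⟨Q, P, hne, hQ, hP⟩ : ∃ Q P : ℂ, (Q ≠ 0 ∨ P ≠ 0) ∧
        (l ^ 2 + l + (g : ℂ) ^ 2) * Q = (κ - 1) * (l + 1) * P ∧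
        (l ^ 2 + l + (g : ℂ) ^ 2) * P = (κ + 1) * (l + 1) * Q := by
      by_cases hκ : (κ : ℂ) = 1
      · have hA : l ^ 2 + l + (g : ℂ) ^ 2 = 0 := by
          rw [hκ] at hD
          simpa using hD
        exact ⟨0, 1, by simp, by simp [hκ], by simp [hA]⟩
      · refine ⟨(κ - 1) * (l + 1), l ^ 2 + l + (g : ℂ) ^ 2,
          Or.inl (mul_ne_zero (sub_ne_zero.mpr hκ) hμ), by ring, by linear_combination hD⟩
    refine ⟨![-g * P, (l + 1) * Q, (l + 1) * Q, -g * P,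
      g * Q, (l + 1) * P, (l + 1) * P, g * Q], ?_, ?_⟩
    · intro h
      have h1 := congrFun h 1
      have h5 := congrFun h 5
      simp [hμ] at h1 h5
      tauto
    · simp
      refine ⟨?_, ?_, ?_, ?_, ?_, ?_, ?_, ?_⟩
      · ring
      · linear_combination -hQ
      · linear_combination -hQ
      · ring
      · ring
      · linear_combination -hP
      · linear_combination -hP
      · ring

theorem re_neg_of_quadratic_eq_zero {b c : ℝ} (hb : 0 < b) (hc : 0 < c) {z : ℂ}
    (hz : z ^ 2 + b * z + c = 0) : z.re < 0 := by
  by_contra! hx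
  have hre := congrArg Complex.re hz
  have him := congrArg Complex.im hz
  simp [pow_two] at hre him
  have hy : z.im = 0 := (mul_eq_zero.mp
    (by linear_combination him : (2 * z.re + b) * z.im = 0)).resolve_left (by positivity)
  rw [hy] at hre
  nlinarith [mul_nonneg hb.le hx, mul_nonneg hx hx]

theorem re_neg_of_quadratic_eq_I_mul {c t : ℝ} (hc : 0 < c) {z : ℂ}
    (hz : z ^ 2 + z + c = Complex.I * t * (z + 1)) : z.re < 0 := by
  by_contra! hx
  have hre := congrArg Complex.re hz
  have him := congrArg Complex.im hz
  simp [pow_two] at hre him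
  have h : z.re * (z.re + 1) ^ 2 + c * (z.re + 1) + z.re * z.im ^ 2 = 0 := by
    linear_combination (z.re + 1) * hre + z.im * him
  have : 0 < c * (z.re + 1) := by positivity
  have : 0 ≤ z.re * (z.re + 1) ^ 2 := by positivity
  have : 0 ≤ z.re * z.im ^ 2 := by positivity
  linarith

theorem exists_root_quadratic_re_nonneg {b c : ℝ} (h : b ≤ 0 ∨ c ≤ 0) :
    ∃ z : ℂ, z ^ 2 + b * z + c = 0 ∧ 0 ≤ z.re := by
  by_cases hb : b ≤ 0
  · obtain ⟨s, hs⟩ := IsAlgClosed.exists_pow_nat_eq ((b : ℂ) ^ 2 - 4 * c) two_pos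
    rcases le_total 0 s.re with h0 | h0
    · refine ⟨(-b + s) / 2, by linear_combination hs / 4, ?_⟩
      simp
      linarith
    · refine ⟨(-b - s) / 2, by linear_combination hs / 4, ?_⟩
      simp
      linarith
  · have hc : c ≤ 0 := h.resolve_left hb
    have hs := Real.sq_sqrt (by nlinarith : 0 ≤ b ^ 2 - 4 * c)
    refine ⟨((-b + √(b ^ 2 - 4 * c)) / 2 : ℝ), ?_, ?_⟩
    · norm_cast
      linear_combination hs / 4
    · have : b ≤ √(b ^ 2 - 4 * c) := Real.le_sqrt_of_sq_le (by linarith)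
      simp only [Complex.ofReal_re]
      linarith

/-- Stability of the drift matrix `Z` of the two-noise model: with `g ≠ 0`,
every complex eigenvalue of `Z` has strictly negative real part if and only if
`κ² < min{1+g⁴, 2}`. -/
theorem stmt_10 (g κ : ℝ) (hg : g ≠ 0)
    (Z : Matrix (Fin 8) (Fin 8) ℝ)
    (hZ : Z = ((1 : ℝ) / 2) •
      !![-1, 0, 0, 0, 0, -g, 0, 0;
          0, 0, 0, 0, -g, κ, -1, 0;
          0, 0, 0, 0, 0, -1, κ, -g;
          0, 0, 0, -1, 0, 0, -g, 0;
          0, g, 0, 0, -1, 0, 0, 0;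
          g, κ, 1, 0, 0, 0, 0, 0;
          0, 1, κ, g, 0, 0, 0, 0;
          0, 0, g, 0, 0, 0, 0, -1]) :
    (∀ μ : ℂ, (Z.map (Complex.ofReal)).charpoly.IsRoot μ → μ.re < 0) ↔
      κ ^ 2 < min (1 + g ^ 4) 2 := by
  have hg2 : 0 < g ^ 2 := by positivity
  change Z = ((1 : ℝ) / 2) • twoNoiseMatrix g κ at hZ
  subst hZ
  have hne {μ : ℂ} (hx : 0 ≤ μ.re) : 2 * μ + 1 ≠ 0 := by
    intro h
    have := congrArg Complex.re h
    simp at this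
    linarith
  constructor
  · intro hstable
    by_contra hκ
    have hκ' : 1 + g ^ 4 ≤ κ ^ 2 ∨ 2 ≤ κ ^ 2 := min_le_iff.mp (not_lt.mp hκ)
    have hr0 : 0 ≤ κ ^ 2 - 1 := by rcases hκ' with h | h <;> nlinarith [sq_nonneg (g ^ 2)]
    have hr := Real.sq_sqrt hr0
    obtain ⟨z, hz, hx⟩ := exists_root_quadratic_re_nonneg
      (b := 1 - √(κ ^ 2 - 1)) (c := g ^ 2 - √(κ ^ 2 - 1)) (by
        rcases hκ' with h | h
        · exact Or.inr (sub_nonpos.mpr (Real.le_sqrt_of_sq_le (by linarith)))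
        · exact Or.inl (sub_nonpos.mpr (Real.le_sqrt_of_sq_le (by linarith))))
    have hr' : ((√(κ ^ 2 - 1) : ℝ) : ℂ) ^ 2 = (κ : ℂ) ^ 2 - 1 := by exact_mod_cast hr
    have hx' : 0 ≤ (z / 2).re := by
      rw [Complex.div_ofNat_re]
      positivity
    refine (hstable (z / 2) ?_).not_ge hx'
    rw [isRoot_charpoly_half_twoNoiseMatrix_iff g κ _ (hne hx'), ← hr',
      mul_div_cancel₀ z two_ne_zero]
    push_cast at hz
    linear_combination (z ^ 2 + z + (g : ℂ) ^ 2 + (√(κ ^ 2 - 1) : ℝ) * (z + 1)) * hz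
  · intro hκ μ hroot
    obtain ⟨hκ1, hκ2⟩ := lt_min_iff.mp hκ
    by_contra! hx
    rw [isRoot_charpoly_half_twoNoiseMatrix_iff g κ μ (hne hx)] at hroot
    suffices (2 * μ).re < 0 by
      simp at this
      linarith
    rcases le_total 1 (κ ^ 2) with h1 | h1
    · have hr := Real.sq_sqrt (sub_nonneg.mpr h1)
      have hr0 := Real.sqrt_nonneg (κ ^ 2 - 1)
      have hr1 : √(κ ^ 2 - 1) < 1 := by
        rw [Real.sqrt_lt' one_pos]
        linarith
      have hr2 : √(κ ^ 2 - 1) < g ^ 2 := by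
        rw [Real.sqrt_lt' hg2]
        linarith
      have hr' : ((√(κ ^ 2 - 1) : ℝ) : ℂ) ^ 2 = (κ : ℂ) ^ 2 - 1 := by exact_mod_cast hr
      rw [← hr', ← mul_pow, sq_eq_sq_iff_eq_or_eq_neg] at hroot
      rcases hroot with h | h
      · refine re_neg_of_quadratic_eq_zero (sub_pos.mpr hr1) (sub_pos.mpr hr2) ?_
        push_cast
        linear_combination h
      · refine re_neg_of_quadratic_eq_zero (b := 1 + √(κ ^ 2 - 1)) (c := g ^ 2 + √(κ ^ 2 - 1))
          (by positivity) (by positivity) ?_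
        push_cast
        linear_combination h
    · have ht := Real.sq_sqrt (sub_nonneg.mpr h1)
      have ht' : (Complex.I * (√(1 - κ ^ 2) : ℝ)) ^ 2 = (κ : ℂ) ^ 2 - 1 := by
        rw [mul_pow, Complex.I_sq, ← Complex.ofReal_pow, ht]
        push_cast
        ring
      rw [← ht', ← mul_pow, sq_eq_sq_iff_eq_or_eq_neg] at hroot
      rcases hroot with h | h
      · refine re_neg_of_quadratic_eq_I_mul (t := √(1 - κ ^ 2)) hg2 ?_
        push_cast
        exact h
      · refine re_neg_of_quadratic_eq_I_mul (t := -√(1 - κ ^ 2)) hg2 ?_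
        push_cast
        linear_combination h
end

section
/- Let g and κ be real numbers, and let Z be the 8×8 real matrix Z = (1/2)·M where the rows of M are (-1,0,0,0,0,-g,0,0), (0,0,0,0,-g,κ,-1,0), (0,0,0,0,0,-1,κ,-g), (0,0,0,-1,0,0,-g,0), (0,g,0,0,-1,0,0,0), (g,κ,1,0,0,0,0,0), (0,1,κ,g,0,0,0,0), (0,0,g,0,0,0,0,-1). Then the characteristic polynomial of Z (in the variable λ) equals the square of the quartic polynomial λ⁴ + λ³ + ((2(1+g²)-κ²)/4)λ² + ((1-κ²+g²)/4)λ + (1-κ²+g⁴)/16. -/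
open Polynomial

/-- A block matrix that is symmetric under exchange of its two halves decouples into the even and
the odd sector. -/
theorem Matrix.charpoly_fromBlocks_swap_symm {R n : Type*} [CommRing R] [Fintype n] [DecidableEq n]
    (A B : Matrix n n R) :
    (Matrix.fromBlocks A B B A).charpoly = (A - B).charpoly * (A + B).charpoly := by
  let P : (Matrix (n ⊕ n) (n ⊕ n) R)ˣ :=
    { val := Matrix.fromBlocks 1 0 1 1
      inv := Matrix.fromBlocks 1 0 (-1) 1
      val_inv := by simp [Matrix.fromBlocks_multiply]
      inv_val := by simp [Matrix.fromBlocks_multiply] }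
  rw [← Matrix.charpoly_fromBlocks_zero₂₁ (A - B) B (A + B), ← Matrix.charpoly_units_conj P]
  congr 1
  rw [← Matrix.coe_units_inv, Units.mul_inv_eq_iff_eq_mul]
  simp [P, Matrix.fromBlocks_multiply, add_comm]

/-- The characteristic polynomial of a sector of the drift matrix; the even and the odd sector are
`u = κ ∓ 1`, `v = κ ± 1`. -/
theorem charpoly_sector (g κ u v : ℝ) (huv : u * v = κ ^ 2 - 1) :
    (((1 : ℝ) / 2) • !![-1, 0, 0, -g; 0, 0, -g, u; 0, g, -1, 0; g, v, 0, 0]).charpoly =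
      X ^ 4 + X ^ 3 + C ((2 * (1 + g ^ 2) - κ ^ 2) / 4) * X ^ 2
        + C ((1 - κ ^ 2 + g ^ 2) / 4) * X + C ((1 - κ ^ 2 + g ^ 4) / 16) := by
  refine Polynomial.funext fun x => ?_
  rw [Matrix.eval_charpoly]
  have hentries : Matrix.scalar (Fin 4) x -
      ((1 : ℝ) / 2) • !![-1, 0, 0, -g; 0, 0, -g, u; 0, g, -1, 0; g, v, 0, 0] =
      !![x + 1 / 2, 0, 0, g / 2; 0, x, g / 2, -u / 2;
        0, -g / 2, x + 1 / 2, 0; -g / 2, -v / 2, 0, x] := by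
    ext i j
    fin_cases i <;> fin_cases j <;> simp <;> ring
  rw [hentries]
  simp [Matrix.det_succ_row_zero, Fin.sum_univ_succ, Fin.succAbove]
  linear_combination (-(x + 1 / 2) ^ 2 / 4) * huv

/-- The even-odd ordering of the coordinates: the second half is the mirror image of the first
under exchange of the modes `0, 1` with the modes `3, 2`. -/
def mirrorEquiv : Fin 8 ≃ Fin 4 ⊕ Fin 4 where
  toFun := ![.inl 0, .inl 1, .inr 1, .inr 0, .inl 2, .inl 3, .inr 3, .inr 2]
  invFun := Sum.elim ![0, 1, 4, 5] ![3, 2, 7, 6]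
  left_inv := by decide
  right_inv := by decide

/-- The characteristic polynomial of the drift matrix `Z` of the two-noise
model is the square of an explicit quartic polynomial. -/
theorem stmt_11 (g κ : ℝ)
    (Z : Matrix (Fin 8) (Fin 8) ℝ)
    (hZ : Z = ((1 : ℝ) / 2) •
      !![-1, 0, 0, 0, 0, -g, 0, 0;
          0, 0, 0, 0, -g, κ, -1, 0;
          0, 0, 0, 0, 0, -1, κ, -g;
          0, 0, 0, -1, 0, 0, -g, 0;
          0, g, 0, 0, -1, 0, 0, 0;
          g, κ, 1, 0, 0, 0, 0, 0;
          0, 1, κ, g, 0, 0, 0, 0;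
          0, 0, g, 0, 0, 0, 0, -1]) :
    Z.charpoly =
      (X ^ 4 + X ^ 3 + C ((2 * (1 + g ^ 2) - κ ^ 2) / 4) * X ^ 2
          + C ((1 - κ ^ 2 + g ^ 2) / 4) * X
          + C ((1 - κ ^ 2 + g ^ 4) / 16)) ^ 2 := by
  let A : Matrix (Fin 4) (Fin 4) ℝ :=
    ((1 : ℝ) / 2) • !![-1, 0, 0, -g; 0, 0, -g, κ; 0, g, -1, 0; g, κ, 0, 0]
  let B : Matrix (Fin 4) (Fin 4) ℝ :=
    ((1 : ℝ) / 2) • !![0, 0, 0, 0; 0, 0, 0, -1; 0, 0, 0, 0; 0, 1, 0, 0]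
  have hblocks : Matrix.reindex mirrorEquiv mirrorEquiv Z = Matrix.fromBlocks A B B A := by
    subst hZ
    ext (i | i) (j | j) <;> fin_cases i <;> fin_cases j <;> simp [A, B, mirrorEquiv]
  have hodd : A - B =
      ((1 : ℝ) / 2) • !![-1, 0, 0, -g; 0, 0, -g, κ + 1; 0, g, -1, 0; g, κ - 1, 0, 0] := by
    ext i j
    fin_cases i <;> fin_cases j <;> simp [A, B] <;> ring
  have heven : A + B =
      ((1 : ℝ) / 2) • !![-1, 0, 0, -g; 0, 0, -g, κ - 1; 0, g, -1, 0; g, κ + 1, 0, 0] := by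
    ext i j
    fin_cases i <;> fin_cases j <;> simp [A, B] <;> ring
  rw [← Matrix.charpoly_reindex mirrorEquiv, hblocks, Matrix.charpoly_fromBlocks_swap_symm,
    hodd, heven, charpoly_sector g κ _ _ (by ring), charpoly_sector g κ _ _ (by ring), ← sq]
end

section
/- Let g, a, b be real numbers with g ≠ 0, a > 1 and b > 1. Let S_red be the real 4×4 matrix S_red = ((a+b)/2)·I₄ + ((a-b)g²/(4(1+g⁴)))·M, where the rows of M are (-(1-g²), 0, 0, -(1+g²)), (0, 1-g², 1+g², 0), (0, 1+g², -(1-g²), 0), (-(1+g²), 0, 0, 1-g²). Let S̃_red be the complex 4×4 matrix obtained from S_red by adding i at entry (1,3), -i at entry (2,4), -i at entry (3,1) and i at entry (4,2). Then the Hermitian matrix S̃_red is positive semidefinite. -/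
open ComplexOrder

/-- A Hermitian matrix `A` with `A * A = r • 1` has spectrum in `{√r, -√r}`, so that `t • 1 + A` is
positive semidefinite once `√r ≤ t`. -/
theorem posSemidef_smul_one_add_of_mul_self_eq {n : Type*} [Fintype n] [DecidableEq n]
    {A : Matrix n n ℂ} (hA : A.IsHermitian) {r t : ℝ} (hAA : A * A = (r : ℂ) • 1)
    (ht : 0 < t) (hrt : r ≤ t ^ 2) : ((t : ℂ) • (1 : Matrix n n ℂ) + A).PosSemidef := by
  have hB : ((t : ℂ) • (1 : Matrix n n ℂ) + A).IsHermitian := by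
    simp [Matrix.IsHermitian, Matrix.conjTranspose_add, Matrix.conjTranspose_smul, hA.eq]
  have hsq := Matrix.posSemidef_conjTranspose_mul_self ((t : ℂ) • (1 : Matrix n n ℂ) + A)
  rw [hB.eq] at hsq
  have hone : (((t ^ 2 - r : ℝ) : ℂ) • (1 : Matrix n n ℂ)).PosSemidef :=
    Matrix.PosSemidef.one.smul (Complex.zero_le_real.mpr (sub_nonneg.mpr hrt))
  have hinv : (0 : ℂ) ≤ ((1 / (2 * t) : ℝ) : ℂ) := Complex.zero_le_real.mpr (by positivity)
  convert (hsq.add hone).smul hinv using 1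
  have htc : (t : ℂ) ≠ 0 := by exact_mod_cast ht.ne'
  simp only [add_mul, mul_add, hAA, Matrix.smul_mul, Matrix.mul_smul, one_mul, mul_one]
  push_cast
  match_scalars <;> field_simp <;> ring

/-- Separability of the stationary state of the two-noise model with `κ = 0`:
for reservoir parameters `a, b > 1` and coupling `g ≠ 0`, the matrix `S̃_red`
(reduced stationary covariance matrix plus the partial-transpose symplectic
correction) is positive semidefinite. -/
theorem stmt_12 (g a b : ℝ) (hg : g ≠ 0) (ha : 1 < a) (hb : 1 < b)
    (Sred : Matrix (Fin 4) (Fin 4) ℝ)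
    (hSred : Sred = ((a + b) / 2) • (1 : Matrix (Fin 4) (Fin 4) ℝ) +
      ((a - b) * g ^ 2 / (4 * (1 + g ^ 4))) •
        !![-(1 - g ^ 2), 0, 0, -(1 + g ^ 2);
           0, 1 - g ^ 2, 1 + g ^ 2, 0;
           0, 1 + g ^ 2, -(1 - g ^ 2), 0;
           -(1 + g ^ 2), 0, 0, 1 - g ^ 2])
    (St : Matrix (Fin 4) (Fin 4) ℂ)
    (hSt : St = Sred.map (Complex.ofReal) +
      !![0, 0, Complex.I, 0;
         0, 0, 0, -Complex.I;
         -Complex.I, 0, 0, 0;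
         0, Complex.I, 0, 0]) :
    St.PosSemidef := by
  set c : ℝ := (a - b) * g ^ 2 / (4 * (1 + g ^ 4)) with hc
  let J : Matrix (Fin 4) (Fin 4) ℂ :=
    !![0, 0, Complex.I, 0; 0, 0, 0, -Complex.I; -Complex.I, 0, 0, 0; 0, Complex.I, 0, 0]
  let p : ℂ := c * (1 - g ^ 2)
  let q : ℂ := c * (1 + g ^ 2)
  let N : Matrix (Fin 4) (Fin 4) ℂ := !![-p, 0, 0, -q; 0, p, q, 0; 0, q, -p, 0; -q, 0, 0, p]
  have hJ : J.IsHermitian := by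
    ext i j; fin_cases i <;> fin_cases j <;> simp [J]
  have hJJ : J * J = ((1 : ℝ) : ℂ) • 1 := by
    ext i j; fin_cases i <;> fin_cases j <;> simp [J, Matrix.mul_apply, Fin.sum_univ_four]
  have hN : N.IsHermitian := by
    ext i j; fin_cases i <;> fin_cases j <;> simp [N, p, q]
  have hNN : N * N = ((c ^ 2 * (2 * (1 + g ^ 4)) : ℝ) : ℂ) • 1 := by
    ext i j
    fin_cases i <;> fin_cases j <;>
      simp [N, p, q, Matrix.mul_apply, Fin.sum_univ_four] <;> ring
  have hg4 : 0 < 1 + g ^ 4 := by positivity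
  have ht : 0 < (a + b) / 2 - 1 := by linarith
  have hbound : c ^ 2 * (2 * (1 + g ^ 4)) ≤ ((a + b) / 2 - 1) ^ 2 := by
    have hval : c ^ 2 * (2 * (1 + g ^ 4)) = (a - b) ^ 2 / 8 * (g ^ 4 / (1 + g ^ 4)) := by
      rw [hc]; field_simp; ring
    have hfrac : g ^ 4 / (1 + g ^ 4) ≤ 1 := by rw [div_le_one hg4]; linarith
    have hle : (a - b) ^ 2 / 8 * (g ^ 4 / (1 + g ^ 4)) ≤ (a - b) ^ 2 / 8 :=
      mul_le_of_le_one_right (by positivity) hfrac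
    nlinarith [mul_pos (sub_pos.mpr ha) (sub_pos.mpr hb), sq_nonneg (a - b)]
  have hsum := (posSemidef_smul_one_add_of_mul_self_eq hJ hJJ one_pos (by norm_num)).add
    (posSemidef_smul_one_add_of_mul_self_eq hN hNN ht hbound)
  convert hsum using 1
  rw [hSt, hSred]
  ext i j
  fin_cases i <;> fin_cases j <;> simp [J, N, p, q] <;> ring
end

section
/- For real numbers a, b, g with g ≠ 0 define D(a,b,g) = (a+b)⁴(1+g⁴)²/(16g⁸) - (2+4g²+5g⁴+3g⁸)(a+b)²/(2g⁸) + ab(a+b)²(1+g⁴)/(2g⁴) - 2ab(2+4g²+g⁴)/g⁴ + 1 + a²b². For all a > 1 and b > 1 satisfying 2(a+b-1)² - (a-b)² < 6, there exists g₀ > 0 such that D(a,b,g) < 0 for every real g with g² ≥ g₀. -/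
/-- In the two-noise model with `κ = 1`, if the reservoir parameters
`a, b > 1` satisfy `2(a+b-1)² - (a-b)² < 6`, then the determinant `D(a,b,g)` of
`S̃_red` is negative (the stationary state is entangled) for all large enough
coupling strengths `g²`. -/
theorem stmt_14 (D : ℝ → ℝ → ℝ → ℝ)
    (hD : ∀ a b g : ℝ, g ≠ 0 → D a b g =
      (a + b) ^ 4 * (1 + g ^ 4) ^ 2 / (16 * g ^ 8)
        - (2 + 4 * g ^ 2 + 5 * g ^ 4 + 3 * g ^ 8) * (a + b) ^ 2 / (2 * g ^ 8)
        + a * b * (a + b) ^ 2 * (1 + g ^ 4) / (2 * g ^ 4)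
        - 2 * a * b * (2 + 4 * g ^ 2 + g ^ 4) / g ^ 4
        + 1 + a ^ 2 * b ^ 2) :
    ∀ a b : ℝ, 1 < a → 1 < b →
      2 * (a + b - 1) ^ 2 - (a - b) ^ 2 < 6 →
      ∃ g₀ : ℝ, 0 < g₀ ∧ ∀ g : ℝ, g₀ ≤ g ^ 2 → D a b g < 0 := by
  intro a b ha hb hab
  have hp : 0 < a * b := by nlinarith
  obtain ⟨L, hL⟩ : ∃ L, L = ((a + b) ^ 2 / 4 + a * b - 1) ^ 2 - (a + b) ^ 2 := ⟨_, rfl⟩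
  obtain ⟨K, hK⟩ : ∃ K, K = 3 * (a + b) ^ 4 / 16 + a * b * (a + b) ^ 2 / 2 := ⟨_, rfl⟩
  have hL0 : L < 0 := by
    have h₁ : (a + b) ^ 2 / 4 + a * b - 1 - (a + b) < 0 := by nlinarith
    have h₂ : 0 < (a + b) ^ 2 / 4 + a * b - 1 + (a + b) := by nlinarith
    have h₃ := mul_neg_of_neg_of_pos h₁ h₂
    rw [hL]
    linarith
  have hK0 : 0 < K := by rw [hK]; positivity
  have hKL : 0 < K / -L := div_pos hK0 (neg_pos.mpr hL0)
  refine ⟨1 + K / -L, by linarith, fun g hg => ?_⟩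
  have hg1 : 1 ≤ g ^ 2 := by linarith
  have hg0 : g ≠ 0 := by
    rintro rfl
    norm_num at hg1
  obtain ⟨x, hx⟩ : ∃ x, x = (g ^ 2)⁻¹ := ⟨_, rfl⟩
  have hx0 : 0 < x := by rw [hx]; positivity
  have hx1 : x ≤ 1 := by rw [hx]; exact inv_le_one_of_one_le₀ hg1
  have hDx : D a b g = L
      + ((a + b) ^ 4 / 16 * (2 * x ^ 2 + x ^ 4) + a * b * (a + b) ^ 2 / 2 * x ^ 2)
      - ((a + b) ^ 2 / 2 * (2 * x ^ 4 + 4 * x ^ 3 + 5 * x ^ 2)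
        + 2 * (a * b) * (2 * x ^ 2 + 4 * x)) := by
    rw [hD a b g hg0, hL, hx]
    field_simp
    ring
  have hxK : x * K < -L := by
    have h₁ : K / -L < g ^ 2 := by linarith
    rw [div_lt_iff₀ (neg_pos.mpr hL0)] at h₁
    rw [hx, inv_mul_lt_iff₀ (by positivity)]
    exact h₁
  have hx2 : x ^ 2 ≤ x := pow_le_of_le_one hx0.le hx1 two_ne_zero
  have hx4 : x ^ 4 ≤ x := pow_le_of_le_one hx0.le hx1 four_ne_zero
  have h₁ : (a + b) ^ 4 / 16 * (2 * x ^ 2 + x ^ 4) ≤ (a + b) ^ 4 / 16 * (3 * x) :=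
    mul_le_mul_of_nonneg_left (by linarith) (by positivity)
  have h₂ : a * b * (a + b) ^ 2 / 2 * x ^ 2 ≤ a * b * (a + b) ^ 2 / 2 * x :=
    mul_le_mul_of_nonneg_left hx2 (by positivity)
  have h₃ : 0 ≤ (a + b) ^ 2 / 2 * (2 * x ^ 4 + 4 * x ^ 3 + 5 * x ^ 2)
      + 2 * (a * b) * (2 * x ^ 2 + 4 * x) := by positivity
  rw [hK] at hxK
  rw [hDx]
  linarith
end

section
/- For real numbers a, b, g with g ≠ 0 define D(a,b,g) = (a+b)⁴(1+g⁴)²/(16g⁸) - (2+4g²+5g⁴+3g⁸)(a+b)²/(2g⁸) + ab(a+b)²(1+g⁴)/(2g⁴) - 2ab(2+4g²+g⁴)/g⁴ + 1 + a²b². Then for all real a, b, the limit of D(a,b,g) as g² → ∞ equals L(a,b) = ((a+b)²/4 + ab - 1)² - (a+b)²; moreover, for a > 1 and b > 1, L(a,b) < 0 if and only if 2(a+b-1)² - (a-b)² < 6. -/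
open Filter

/-- In the two-noise model with `κ = 1`, the determinant `D(a,b,g)` of
`S̃_red` converges, as `g² → ∞`, to `L(a,b) = ((a+b)²/4 + ab - 1)² - (a+b)²`;
moreover, for reservoir parameters `a, b > 1`, the limit `L(a,b)` is negative
if and only if `2(a+b-1)² - (a-b)² < 6`. -/
theorem stmt_15 (D : ℝ → ℝ → ℝ → ℝ)
    (hD : ∀ a b g : ℝ, g ≠ 0 → D a b g =
      (a + b) ^ 4 * (1 + g ^ 4) ^ 2 / (16 * g ^ 8)
        - (2 + 4 * g ^ 2 + 5 * g ^ 4 + 3 * g ^ 8) * (a + b) ^ 2 / (2 * g ^ 8)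
        + a * b * (a + b) ^ 2 * (1 + g ^ 4) / (2 * g ^ 4)
        - 2 * a * b * (2 + 4 * g ^ 2 + g ^ 4) / g ^ 4
        + 1 + a ^ 2 * b ^ 2)
    (L : ℝ → ℝ → ℝ)
    (hL : ∀ a b : ℝ, L a b = ((a + b) ^ 2 / 4 + a * b - 1) ^ 2 - (a + b) ^ 2) :
    (∀ a b : ℝ,
      Tendsto (fun g : ℝ => D a b g) (comap (fun g : ℝ => g ^ 2) atTop)
        (nhds (L a b))) ∧
    ∀ a b : ℝ, 1 < a → 1 < b →
      (L a b < 0 ↔ 2 * (a + b - 1) ^ 2 - (a - b) ^ 2 < 6) := by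
  refine ⟨fun a b => ?_, fun a b ha hb => ?_⟩
  · have hsq : Tendsto (fun g : ℝ => g ^ 2) (comap (fun g : ℝ => g ^ 2) atTop) atTop :=
      tendsto_comap
    have hinv : Tendsto (fun g : ℝ => (g ^ 2)⁻¹) (comap (fun g : ℝ => g ^ 2) atTop) (nhds 0) :=
      tendsto_inv_atTop_zero.comp hsq
    have hcont : Continuous fun u : ℝ =>
        (a + b) ^ 4 * (u ^ 2 + 1) ^ 2 / 16
          - (2 * u ^ 4 + 4 * u ^ 3 + 5 * u ^ 2 + 3) * (a + b) ^ 2 / 2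
          + a * b * (a + b) ^ 2 * (u ^ 2 + 1) / 2
          - 2 * a * b * (2 * u ^ 2 + 4 * u + 1)
          + 1 + a ^ 2 * b ^ 2 := by fun_prop
    have hlim := (hcont.tendsto 0).comp hinv
    have hL0 : L a b = (a + b) ^ 4 * ((0 : ℝ) ^ 2 + 1) ^ 2 / 16
          - (2 * (0 : ℝ) ^ 4 + 4 * (0 : ℝ) ^ 3 + 5 * (0 : ℝ) ^ 2 + 3) * (a + b) ^ 2 / 2
          + a * b * (a + b) ^ 2 * ((0 : ℝ) ^ 2 + 1) / 2
          - 2 * a * b * (2 * (0 : ℝ) ^ 2 + 4 * 0 + 1)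
          + 1 + a ^ 2 * b ^ 2 := by
      rw [hL]; ring
    rw [hL0]
    refine hlim.congr' ?_
    filter_upwards [hsq.eventually_gt_atTop 0] with g hg
    have hg0 : g ≠ 0 := by
      rintro rfl
      norm_num at hg
    rw [hD a b g hg0]
    simp only [Function.comp_apply]
    field_simp
  · have hab : 1 < a * b := by nlinarith
    have hpos : 0 < (a + b) ^ 2 / 4 + a * b - 1 := by nlinarith [sq_nonneg (a + b)]
    rw [hL, sub_neg, sq_lt_sq₀ hpos.le (by linarith)]
    constructor <;> intro h <;> nlinarith
end

section
/- Let b and g be real numbers with b ≥ 1 and g ≠ 0. Then (2b²+2b-1)g⁴ + 2bg² + b² + 2b > 0, and (2b²-2b-1)g⁴ - 2bg² + b² - 2b < 0 if and only if b < (1 + g² + g⁴ + √((1+g²+g⁴)² + g⁴(1+2g⁴))) / (1 + 2g⁴). -/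
/-- Sign analysis of the two factors of `g⁸` times the determinant of `S̃_red`
in the two-noise model with `κ = 1` and equal reservoir parameters `b ≥ 1`:
the first factor is always positive, and the second one is negative precisely
when `b < (1 + g² + g⁴ + √((1+g²+g⁴)² + g⁴(1+2g⁴)))/(1+2g⁴)`. -/
theorem stmt_17 (b g : ℝ) (hb : 1 ≤ b) (hg : g ≠ 0) :
    0 < (2 * b ^ 2 + 2 * b - 1) * g ^ 4 + 2 * b * g ^ 2 + b ^ 2 + 2 * b ∧
      ((2 * b ^ 2 - 2 * b - 1) * g ^ 4 - 2 * b * g ^ 2 + b ^ 2 - 2 * b < 0 ↔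
        b < (1 + g ^ 2 + g ^ 4 +
              Real.sqrt ((1 + g ^ 2 + g ^ 4) ^ 2 + g ^ 4 * (1 + 2 * g ^ 4)))
            / (1 + 2 * g ^ 4)) := by
  have hg4 : 0 < g ^ 4 := by positivity
  have hA : 0 < 1 + 2 * g ^ 4 := by positivity
  have hB : 0 < 1 + g ^ 2 + g ^ 4 := by positivity
  refine ⟨?_, ?_⟩
  · have h1 : 0 < 2 * b ^ 2 + 2 * b - 1 := by nlinarith
    positivity
  · have hD : (2 * b ^ 2 - 2 * b - 1) * g ^ 4 - 2 * b * g ^ 2 + b ^ 2 - 2 * b =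
        (1 + 2 * g ^ 4) * b ^ 2 - 2 * (1 + g ^ 2 + g ^ 4) * b - g ^ 4 := by ring
    rw [hD, lt_div_iff₀ hA]
    generalize 1 + 2 * g ^ 4 = A at *
    generalize 1 + g ^ 2 + g ^ 4 = B at *
    have hAb : 0 < b * A := by positivity
    have hsB : B ≤ √(B ^ 2 + g ^ 4 * A) := Real.le_sqrt_of_sq_le (by nlinarith)
    have hsq : √(B ^ 2 + g ^ 4 * A) ^ 2 = B ^ 2 + g ^ 4 * A := Real.sq_sqrt (by positivity)
    calc A * b ^ 2 - 2 * B * b - g ^ 4 < 0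
        ↔ A * (A * b ^ 2 - 2 * B * b - g ^ 4) < 0 := by
          rw [← mul_lt_mul_iff_right₀ hA, mul_zero]
      _ ↔ (b * A - B) ^ 2 < √(B ^ 2 + g ^ 4 * A) ^ 2 := by
          rw [hsq]; constructor <;> intro h <;> linarith
      _ ↔ b * A < B + √(B ^ 2 + g ^ 4 * A) := by
          rw [sq_lt_sq, abs_of_nonneg (Real.sqrt_nonneg _), abs_lt, sub_lt_iff_lt_add',
            and_iff_right (by linarith)]
end

section
/- Define for real g the function T(g) = (1 + g² + g⁴ + √((1+g²+g⁴)² + g⁴(1+2g⁴))) / (1 + 2g⁴). Then T(g) tends to (1+√3)/2 as |g| → ∞, and for real g one has T(g) = 2 if and only if g = 0 or g = 2/√3 or g = -2/√3. -/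
open Filter

/-- The threshold written in the variable `g⁻¹`, in which it extends continuously to `0`. -/
lemma threshold_eq_of_ne_zero {g : ℝ} (hg : g ≠ 0) :
    (1 + g ^ 2 + g ^ 4 + Real.sqrt ((1 + g ^ 2 + g ^ 4) ^ 2 + g ^ 4 * (1 + 2 * g ^ 4)))
        / (1 + 2 * g ^ 4) =
      (1 + g⁻¹ ^ 2 + g⁻¹ ^ 4 + Real.sqrt ((1 + g⁻¹ ^ 2 + g⁻¹ ^ 4) ^ 2 + (2 + g⁻¹ ^ 4)))
        / (2 + g⁻¹ ^ 4) := by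
  have hsqrt : Real.sqrt ((1 + g ^ 2 + g ^ 4) ^ 2 + g ^ 4 * (1 + 2 * g ^ 4)) =
      g ^ 4 * Real.sqrt ((1 + g⁻¹ ^ 2 + g⁻¹ ^ 4) ^ 2 + (2 + g⁻¹ ^ 4)) := by
    rw [show (1 + g ^ 2 + g ^ 4) ^ 2 + g ^ 4 * (1 + 2 * g ^ 4) =
      (g ^ 4) ^ 2 * ((1 + g⁻¹ ^ 2 + g⁻¹ ^ 4) ^ 2 + (2 + g⁻¹ ^ 4)) by field_simp; ring,
      Real.sqrt_mul (by positivity), Real.sqrt_sq (by positivity)]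
  have hnum : 1 + g ^ 2 + g ^ 4 = g ^ 4 * (1 + g⁻¹ ^ 2 + g⁻¹ ^ 4) := by field_simp; ring
  have hden : 1 + 2 * g ^ 4 = g ^ 4 * (2 + g⁻¹ ^ 4) := by field_simp; ring
  rw [hsqrt, hnum, hden, ← mul_add, mul_div_mul_left _ _ (by positivity)]

/-- The threshold equals `2` exactly when `g² (3 g² - 4) = 0`. -/
lemma threshold_eq_two_iff (g : ℝ) :
    (1 + g ^ 2 + g ^ 4 + Real.sqrt ((1 + g ^ 2 + g ^ 4) ^ 2 + g ^ 4 * (1 + 2 * g ^ 4)))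
        / (1 + 2 * g ^ 4) = 2 ↔ g ^ 2 * (3 * g ^ 2 - 4) = 0 := by
  have hpos : 0 ≤ 1 - g ^ 2 + 3 * g ^ 4 := by nlinarith [sq_nonneg (g ^ 2 - 1)]
  have hden : 0 < 1 + 2 * g ^ 4 := by positivity
  have hsqrt : Real.sqrt ((1 + g ^ 2 + g ^ 4) ^ 2 + g ^ 4 * (1 + 2 * g ^ 4)) =
      1 - g ^ 2 + 3 * g ^ 4 ↔
      (1 + g ^ 2 + g ^ 4) ^ 2 + g ^ 4 * (1 + 2 * g ^ 4) = (1 - g ^ 2 + 3 * g ^ 4) ^ 2 :=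
    Real.sqrt_eq_iff_eq_sq (by positivity) hpos
  rw [div_eq_iff hden.ne']
  constructor
  · intro h
    have hs := hsqrt.1 (by linarith)
    refine (mul_eq_zero.1 (?_ : (1 + 2 * g ^ 4) * (g ^ 2 * (3 * g ^ 2 - 4)) = 0)).resolve_left
      hden.ne'
    linear_combination -hs
  · intro h
    have hs := hsqrt.2 (by linear_combination -(1 + 2 * g ^ 4) * h)
    rw [hs]
    ring

/-- Properties of the temperature threshold
`T(g) = (1 + g² + g⁴ + √((1+g²+g⁴)² + g⁴(1+2g⁴)))/(1+2g⁴)` of the two-noise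
model with `κ = 1`: `T(g) → (1+√3)/2` as `|g| → ∞`, and `T(g) = 2` exactly for
`g = 0` and `g = ±2/√3`. -/
theorem stmt_18 (T : ℝ → ℝ)
    (hT : ∀ g : ℝ, T g =
      (1 + g ^ 2 + g ^ 4 +
          Real.sqrt ((1 + g ^ 2 + g ^ 4) ^ 2 + g ^ 4 * (1 + 2 * g ^ 4)))
        / (1 + 2 * g ^ 4)) :
    Tendsto T (comap (fun g : ℝ => |g|) atTop)
        (nhds ((1 + Real.sqrt 3) / 2)) ∧
      ∀ g : ℝ, (T g = 2 ↔
        g = 0 ∨ g = 2 / Real.sqrt 3 ∨ g = -(2 / Real.sqrt 3)) := by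
  constructor
  · have hinv : Tendsto (fun g : ℝ => g⁻¹) (comap (fun g : ℝ => |g|) atTop) (nhds 0) :=
      tendsto_zero_iff_abs_tendsto_zero _ |>.2 <| by
        simpa only [Function.comp_def, abs_inv] using
          tendsto_inv_atTop_zero.comp (tendsto_comap (f := fun g : ℝ => |g|) (x := atTop))
    have hcont : Continuous fun u : ℝ =>
        (1 + u ^ 2 + u ^ 4 + Real.sqrt ((1 + u ^ 2 + u ^ 4) ^ 2 + (2 + u ^ 4))) / (2 + u ^ 4) :=
      Continuous.div (by fun_prop) (by fun_prop) fun u => by positivity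
    have hlim := (hcont.tendsto' 0 ((1 + Real.sqrt 3) / 2) (by norm_num)).comp hinv
    refine hlim.congr' ?_
    filter_upwards [tendsto_comap.eventually (eventually_gt_atTop (0 : ℝ))] with g hg
    rw [hT, threshold_eq_of_ne_zero (abs_pos.1 hg), Function.comp_apply]
  · intro g
    rw [hT, threshold_eq_two_iff, mul_eq_zero, pow_eq_zero_iff two_ne_zero,
      ← sq_eq_sq_iff_eq_or_eq_neg, div_pow, Real.sq_sqrt (by norm_num)]
    refine or_congr_right ⟨fun h => ?_, fun h => ?_⟩ <;> linarith
end

section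
/- Let b and g be real numbers with b > 1 and g ≠ 0, and define P(b,g) = b⁴(2g⁴+1)² - 2b²(4g⁸+4g⁶+7g⁴+4g²+2) + g⁸, and for 2b²-2b-1 > 0 define r₋(b) = (b - √(2b(b-1)(-b²+2b+1)))/(2b²-2b-1) and r₊(b) = (b + √(2b(b-1)(-b²+2b+1)))/(2b²-2b-1). Then P(b,g) < 0 if and only if one of the following holds: (1) 1 < b ≤ (1+√3)/2; (2) (1+√3)/2 < b ≤ 2 and 0 < g² < r₊(b); (3) 2 < b < 1+√2 and r₋(b) < g² < r₊(b). In particular, if b ≥ 1+√2 then P(b,g) ≥ 0 for all g. -/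
/-- For `a > 0`, a quadratic `a x² - 2 b x + c` is negative exactly strictly between its roots. -/
theorem quadratic_neg_iff_between_roots {a b c d x : ℝ} (ha : 0 < a) (hd : 0 ≤ d)
    (h : d = b ^ 2 - a * c) :
    a * x ^ 2 - 2 * b * x + c < 0 ↔ (b - √d) / a < x ∧ x < (b + √d) / a := by
  have hs : √d ^ 2 = d := Real.sq_sqrt hd
  have hs0 := Real.sqrt_nonneg d
  have hsq : a * (a * x ^ 2 - 2 * b * x + c) = (x * a - b) ^ 2 - √d ^ 2 := by
    rw [hs, h]; ring
  have hneg : a * x ^ 2 - 2 * b * x + c < 0 ↔ a * (a * x ^ 2 - 2 * b * x + c) < 0 :=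
    ⟨mul_neg_of_pos_of_neg ha, fun h ↦ neg_of_mul_neg_right h ha.le⟩
  rw [div_lt_iff₀ ha, lt_div_iff₀ ha, hneg, hsq, sub_neg, sq_lt_sq,
    abs_of_nonneg hs0, abs_lt]
  constructor <;> rintro ⟨h₁, h₂⟩ <;> constructor <;> linarith

/-- For `a > 0`, a quadratic `a x² - 2 b x + c` with nonpositive discriminant is nonnegative. -/
theorem quadratic_nonneg_of_discr_nonpos {a b c : ℝ} (x : ℝ) (ha : 0 < a)
    (h : b ^ 2 - a * c ≤ 0) : 0 ≤ a * x ^ 2 - 2 * b * x + c := by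
  refine nonneg_of_mul_nonneg_right (a := a) ?_ ha
  nlinarith [sq_nonneg (a * x - b)]

/-- Classification of entangled stationary states in the two-noise model with
`κ = 1` and equal reservoir parameters `β̃₀ = β̃₃ = b`: the (rescaled)
determinant `P(b,g)` of `S̃_red` is negative exactly in the three temperature
regimes listed, and never for `b ≥ 1 + √2`. -/
theorem stmt_19 (P : ℝ → ℝ → ℝ)
    (hP : ∀ b g : ℝ, P b g =
      b ^ 4 * (2 * g ^ 4 + 1) ^ 2
        - 2 * b ^ 2 * (4 * g ^ 8 + 4 * g ^ 6 + 7 * g ^ 4 + 4 * g ^ 2 + 2)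
        + g ^ 8)
    (rm rp : ℝ → ℝ)
    (hrm : ∀ b : ℝ, 2 * b ^ 2 - 2 * b - 1 > 0 → rm b =
      (b - Real.sqrt (2 * b * (b - 1) * (-b ^ 2 + 2 * b + 1)))
        / (2 * b ^ 2 - 2 * b - 1))
    (hrp : ∀ b : ℝ, 2 * b ^ 2 - 2 * b - 1 > 0 → rp b =
      (b + Real.sqrt (2 * b * (b - 1) * (-b ^ 2 + 2 * b + 1)))
        / (2 * b ^ 2 - 2 * b - 1))
    (b g : ℝ) (hb : 1 < b) (hg : g ≠ 0) :
    (P b g < 0 ↔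
      (1 < b ∧ b ≤ (1 + Real.sqrt 3) / 2) ∨
      ((1 + Real.sqrt 3) / 2 < b ∧ b ≤ 2 ∧ 0 < g ^ 2 ∧ g ^ 2 < rp b) ∨
      (2 < b ∧ b < 1 + Real.sqrt 2 ∧ rm b < g ^ 2 ∧ g ^ 2 < rp b)) ∧
    (1 + Real.sqrt 2 ≤ b → 0 ≤ P b g) := by
  have h2 : √2 ^ 2 = 2 := Real.sq_sqrt (by norm_num)
  have h3 : √3 ^ 2 = 3 := Real.sq_sqrt (by norm_num)
  have h20 := Real.sqrt_nonneg 2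
  have h30 := Real.sqrt_nonneg 3
  have h2' : 1 < √2 := by nlinarith
  have h3' : √3 < 2 := by nlinarith
  have hx : 0 < g ^ 2 := by positivity
  set x := g ^ 2 with hxdef
  set D := 2 * b ^ 2 - 2 * b - 1 with hD
  have hfactor : P b g = (D * x ^ 2 - 2 * b * x + (b ^ 2 - 2 * b)) *
      ((2 * b ^ 2 + 2 * b - 1) * x ^ 2 + 2 * b * x + (b ^ 2 + 2 * b)) := by
    rw [hP, hD, hxdef]; ring
  have hpos : 0 < (2 * b ^ 2 + 2 * b - 1) * x ^ 2 + 2 * b * x + (b ^ 2 + 2 * b) := by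
    have : 0 < 2 * b ^ 2 + 2 * b - 1 := by nlinarith
    positivity
  have hneg : P b g < 0 ↔ D * x ^ 2 - 2 * b * x + (b ^ 2 - 2 * b) < 0 := by
    rw [hfactor]
    exact ⟨fun h ↦ neg_of_mul_neg_left h hpos.le, fun h ↦ mul_neg_of_neg_of_pos h hpos⟩
  have hdisc : 2 * b * (b - 1) * (-b ^ 2 + 2 * b + 1) = b ^ 2 - D * (b ^ 2 - 2 * b) := by
    rw [hD]; ring
  have hbb : 0 < 2 * b * (b - 1) := mul_pos (by linarith) (by linarith)
  have hhigh : 1 + √2 ≤ b → 0 ≤ D * x ^ 2 - 2 * b * x + (b ^ 2 - 2 * b) := fun h ↦ by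
    refine quadratic_nonneg_of_discr_nonpos x (by nlinarith) ?_
    rw [← hdisc]
    exact mul_nonpos_of_nonneg_of_nonpos hbb.le (by nlinarith)
  refine ⟨?_, fun h ↦ by rw [hfactor]; exact mul_nonneg (hhigh h) hpos.le⟩
  rw [hneg]
  rcases le_or_gt b ((1 + √3) / 2) with hb3 | hb3
  · refine iff_of_true ?_ (Or.inl ⟨hb, hb3⟩)
    have hD0 : D ≤ 0 := by rw [hD]; nlinarith
    nlinarith [mul_nonneg (neg_nonneg.mpr hD0) (sq_nonneg x), mul_pos (zero_lt_one.trans hb) hx]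
  have hDpos : 0 < D := by rw [hD]; nlinarith
  rw [hrm b hDpos, hrp b hDpos, ← hD]
  rcases le_or_gt (1 + √2) b with hb2 | hb2
  · refine iff_of_false (hhigh hb2).not_gt ?_
    rintro (⟨_, _⟩ | ⟨_, _, _⟩ | ⟨_, _, _⟩) <;> linarith
  have hd : 0 ≤ 2 * b * (b - 1) * (-b ^ 2 + 2 * b + 1) :=
    mul_nonneg hbb.le (by nlinarith)
  rw [quadratic_neg_iff_between_roots hDpos hd hdisc]
  rcases le_or_gt b 2 with hb1 | hb1
  · have hroot : (b - √(2 * b * (b - 1) * (-b ^ 2 + 2 * b + 1))) / D ≤ 0 := by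
      refine div_nonpos_of_nonpos_of_nonneg (sub_nonpos.mpr (Real.le_sqrt_of_sq_le ?_)) hDpos.le
      rw [hdisc]
      nlinarith [mul_nonneg hDpos.le (mul_nonneg (zero_lt_one.trans hb).le (sub_nonneg.mpr hb1))]
    simp [hb3, hb3.not_ge, hb1, hb1.not_gt, hx, hroot.trans_lt hx]
  · simp [hb3.not_ge, hb1, hb1.not_ge, hb2]
end
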